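/- Measurability of the gentle sets. Let Γ, γ be moderately steep scales and let B_k(ω), G_k(ω), 𝒢_k(ω) be defined by the recursive classification of badness starting from B_0(ω) = {x : ω_x = 1}. Then for every x ∈ ℤ^d and every k ≥ 0 the event {ω : x ∈ G_k(ω)} belongs to the σ-algebra 𝒜_{O_{θ_k}(x)} generated by the coordinates ω_y with y ∈ O_{θ_k}(x), and for every finite X ⊆ ℤ^d and k ≥ 1 the event {ω : X ∈ 𝒢_k(ω)} belongs to 𝒜_{O_{θ_k}(X)}. -/

import Mathlib

namespace Paper

open MeasureTheory

noncomputable section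

/-- The lattice `ℤ^d`. -/
abbrev ZLat (d : ℕ) := Fin d → ℤ

/-- A disorder configuration `ω ∈ {0,1}^{ℤ^d}` (`true` = bad site). -/
abbrev DConf (d : ℕ) := ZLat d → Bool

/-- The `ℓ¹` distance on `ℤ^d`. -/
def D1 {d : ℕ} (x y : ZLat d) : ℕ := ∑ i, (x i - y i).natAbs

/-- The sup distance on `ℤ^d`. -/
def supD {d : ℕ} (x y : ZLat d) : ℕ := Finset.univ.sup fun i => (x i - y i).natAbs

/-- The `ℓ¹` ball `O_r(x)` of (real) radius `r` around `x`. -/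
def ball1 {d : ℕ} (x : ZLat d) (r : ℝ) : Set (ZLat d) := {y | (D1 x y : ℝ) ≤ r}

/-- The `ℓ¹` neighborhood `O_r(X)` of a set `X`. -/
def nbd1 {d : ℕ} (X : Set (ZLat d)) (r : ℝ) : Set (ZLat d) :=
  {y | ∃ x ∈ X, (D1 x y : ℝ) ≤ r}

/-- The σ-algebra `𝒜_Λ` generated by the coordinates in `Λ`. -/
def cylSigma {d : ℕ} (Λ : Set (ZLat d)) : MeasurableSpace (DConf d) :=
  MeasurableSpace.comap (fun ω => fun x : Λ => ω x) inferInstance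

/-- `f` is a local function with support contained in the finite set `S`. -/
def LocalOn {d : ℕ} (f : DConf d → ℝ) (S : Finset (ZLat d)) : Prop :=
  ∀ σ τ : DConf d, (∀ x ∈ S, σ x = τ x) → f σ = f τ

/-- Sup norm of a real valued function. -/
def supNorm {α : Type*} (f : α → ℝ) : ℝ := ⨆ a, |f a|

/-- The `ℓ¹` distance between two finite subsets of the lattice. -/
def fDist1 {d : ℕ} (A B : Finset (ZLat d)) : ℝ :=
  sInf ((fun p : ZLat d × ZLat d => (D1 p.1 p.2 : ℝ)) '' {p | p.1 ∈ A ∧ p.2 ∈ B})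

/-- The decay condition (smin): exponential decay of correlations of `Q`. -/
def Smin {d : ℕ} (Q : Measure (DConf d)) (b'' B'' : ℝ) : Prop :=
  ∀ (f g : DConf d → ℝ) (Sf Sg : Finset (ZLat d)),
    LocalOn f Sf → LocalOn g Sg →
    (min Sf.card Sg.card : ℝ) * Real.exp (-b'' * fDist1 Sf Sg) ≤ 1 →
    |(∫ ω, f ω * g ω ∂Q) - (∫ ω, f ω ∂Q) * ∫ ω, g ω ∂Q| ≤
      B'' * supNorm f * supNorm g * (min Sf.card Sg.card : ℝ) *
        Real.exp (-b'' * fDist1 Sf Sg)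

/-- `θ_j = ∑_{i=0}^{j} (Γ_i + γ_i)`. -/
def theta (Γ γ : ℕ → ℝ) (j : ℕ) : ℝ := ∑ i ∈ Finset.range (j + 1), (Γ i + γ i)

/-- Moderately steep scales, with parameters `a > 0` and `ε ∈ (0,1)`
(items (1)–(5) of the definition). -/
structure ModSteep (d : ℕ) (Γ γ : ℕ → ℝ) (a ε : ℝ) : Prop where
  gammaBigMono : StrictMono Γ
  gammaSmallMono : StrictMono γ
  gammaBigZero : Γ 0 = 0
  gammaSmallZero : 0 ≤ γ 0
  gammaBigOne : 2 ≤ Γ 1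
  halfLt : ∀ j : ℕ, 1 ≤ j → Γ j < γ j / 2
  lam : ∀ j : ℕ, 10 * theta Γ γ j ≤ Γ (j + 1)
  covolSummable : Summable (fun j : ℕ => if j = 0 then (0 : ℝ) else Γ j / γ j)
  covol : (∑' j : ℕ, if j = 0 then (0 : ℝ) else Γ j / γ j) ≤ 1 / 2
  apos : 0 < a
  epsMem : ε ∈ Set.Ioo (0 : ℝ) 1
  growth : ∀ k : ℕ, 2 * 3 ^ d * theta Γ γ (k + 1) ^ d ≤ Real.exp (a * (1 + ε) ^ k)
  tail : ∀ s : ℝ, 0 ≤ s → ∀ q : ℝ, 1 < q →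
    Summable fun k : ℕ => theta Γ γ k ^ s * Real.exp (-a * (1 + ε) ^ k / q)

/-- `x` is a gentle point at level `k ≥ 1` with respect to the set `Bprev` of
`(k-1)`-bad points: `x ∈ Bprev`, the atom `A = O_{Γ_k}(x) ∩ Bprev` has `ℓ¹` diameter
at most `Γ_k`, and `D(A, Bprev ∖ A) > γ_k`. -/
def gentleOn {d : ℕ} (Γ γ : ℕ → ℝ) (Bprev : Set (ZLat d)) (k : ℕ) (x : ZLat d) : Prop :=
  x ∈ Bprev ∧
  (∀ u ∈ ball1 x (Γ k) ∩ Bprev, ∀ v ∈ ball1 x (Γ k) ∩ Bprev, (D1 u v : ℝ) ≤ Γ k) ∧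
  (∀ u ∈ ball1 x (Γ k) ∩ Bprev, ∀ v ∈ Bprev \ (ball1 x (Γ k) ∩ Bprev),
    γ k < (D1 u v : ℝ))

/-- The recursive classification of badness: `B_0(ω) = {x : ω_x = 1}` and
`B_k(ω) = B_{k-1}(ω)` minus the `k`-gentle points. -/
def badSet {d : ℕ} (Γ γ : ℕ → ℝ) (ω : DConf d) : ℕ → Set (ZLat d)
  | 0 => {x | ω x = true}
  | k + 1 => {x | x ∈ badSet Γ γ ω k ∧ ¬ gentleOn Γ γ (badSet Γ γ ω k) (k + 1) x}

/-- The `k`-gentle sites: `G_0(ω) = {x : ω_x = 0}`, `G_k(ω) = B_{k-1}(ω) ∖ B_k(ω)`. -/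
def gentleSet {d : ℕ} (Γ γ : ℕ → ℝ) (ω : DConf d) : ℕ → Set (ZLat d)
  | 0 => {x | ω x = false}
  | k + 1 => badSet Γ γ ω k \ badSet Γ γ ω (k + 1)

/-- The collection of `k`-gentle atoms `𝒢_k(ω)` (for `k ≥ 1`):
`A = O_{Γ_k}(x) ∩ B_{k-1}(ω)` for `x` a `k`-gentle point. -/
def atomsAt {d : ℕ} (Γ γ : ℕ → ℝ) (ω : DConf d) (k : ℕ) : Set (Set (ZLat d)) :=
  {A | ∃ x : ZLat d, gentleOn Γ γ (badSet Γ γ ω (k - 1)) k x ∧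
        A = ball1 x (Γ k) ∩ badSet Γ γ ω (k - 1)}

/-- The smallest coordinate parallelepiped `Env(g)` containing `g`. -/
def env {d : ℕ} (g : Set (ZLat d)) : Set (ZLat d) :=
  {x | ∀ i : Fin d, (∃ u ∈ g, u i ≤ x i) ∧ ∃ v ∈ g, x i ≤ v i}

/-- The residual bad sets of a graded family of atoms:
`B_0 = 𝕃 ∖ G_0`, `B_j = B_{j-1} ∖ ⋃(atoms of grade j)`. -/
def Bres {d : ℕ} (G0 : Set (ZLat d)) (atoms : ℕ → Set (Set (ZLat d))) : ℕ → Set (ZLat d)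
  | 0 => G0ᶜ
  | k + 1 => Bres G0 atoms k \ ⋃ g ∈ atoms (k + 1), g

/-- A gentle disintegration of `ℤ^d` with respect to `G0` and the scales `Γ, γ`. -/
structure GentleDisintegration (d : ℕ) (G0 : Set (ZLat d)) (Γ γ : ℕ → ℝ) where
  atoms : ℕ → Set (Set (ZLat d))
  atomFinite : ∀ j, ∀ g ∈ atoms j, g.Finite
  atomNonempty : ∀ j, ∀ g ∈ atoms j, g.Nonempty
  uniqueGrade : ∀ j j' g, g ∈ atoms j → g ∈ atoms j' → j = j'
  pairwiseDisjoint : ∀ j j' g g', g ∈ atoms j → g' ∈ atoms j' → g ≠ g' → Disjoint g g'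
  cover : ∀ x : ZLat d, ∃ j, ∃ g ∈ atoms j, x ∈ g
  grade0 : atoms 0 = {s | ∃ x ∈ G0, s = {x}}
  subsBad : ∀ j, ∀ g ∈ atoms (j + 1), g ⊆ Bres G0 atoms j
  diamBound : ∀ j, 1 ≤ j → ∀ g ∈ atoms j, ∀ u ∈ g, ∀ v ∈ g, (D1 u v : ℝ) ≤ Γ j
  separation : ∀ j, ∀ g ∈ atoms (j + 1), ∀ u ∈ g, ∀ v ∈ Bres G0 atoms j \ g,
    γ (j + 1) < (D1 u v : ℝ)
  horizon : ∀ x : ZLat d,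
    {j : ℕ | 1 ≤ j ∧ ∃ g ∈ atoms j, ∃ y ∈ env g, (supD x y : ℝ) ≤ theta Γ γ j}.Finite


theorem D1_self {d : ℕ} (x : ZLat d) : D1 x x = 0 := by simp [D1]

theorem D1_triangle {d : ℕ} (x y z : ZLat d) : D1 x z ≤ D1 x y + D1 y z := by
  unfold D1
  rw [← Finset.sum_add_distrib]
  exact Finset.sum_le_sum fun i _ => by omega

theorem mem_ball1_of_le {d : ℕ} {x y z : ZLat d} {r s t : ℝ} (hy : y ∈ ball1 x r)
    (hz : (D1 y z : ℝ) ≤ s) (h : r + s ≤ t) : z ∈ ball1 x t := by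
  have hy' : (D1 x y : ℝ) ≤ r := hy
  have ht : (D1 x z : ℝ) ≤ D1 x y + D1 y z := by exact_mod_cast D1_triangle x y z
  change (D1 x z : ℝ) ≤ t
  linarith

theorem mem_ball1_self {d : ℕ} (x : ZLat d) {r : ℝ} (hr : 0 ≤ r) : x ∈ ball1 x r := by
  simpa [ball1, D1_self] using hr

theorem finite_ball1 {d : ℕ} (x : ZLat d) (r : ℝ) : (ball1 x r).Finite := by
  refine (Set.finite_Icc (fun i => x i - ⌊r⌋₊) (fun i => x i + ⌊r⌋₊)).subset fun y hy => ?_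
  have hy' : D1 x y ≤ ⌊r⌋₊ := Nat.le_floor hy
  have hi (i : Fin d) : (x i - y i).natAbs ≤ ⌊r⌋₊ :=
    (Finset.single_le_sum (f := fun i => (x i - y i).natAbs)
      (fun _ _ => Nat.zero_le _) (Finset.mem_univ i)).trans hy'
  constructor <;> intro i <;> have := hi i <;> dsimp only <;> omega

theorem finite_nbd1 {d : ℕ} {X : Set (ZLat d)} (hX : X.Finite) (r : ℝ) : (nbd1 X r).Finite := by
  have h : nbd1 X r = ⋃ x ∈ X, ball1 x r := by
    ext y
    simp [nbd1, ball1]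
  rw [h]
  exact hX.biUnion fun x _ => finite_ball1 x r

/-- An event depending only on the coordinates in a finite set `Λ` belongs to `𝒜_Λ`. -/
theorem measurableSet_cylSigma_of_local {d : ℕ} {Λ : Set (ZLat d)} (hΛ : Λ.Finite)
    {S : Set (DConf d)}
    (hS : ∀ σ τ : DConf d, (∀ x ∈ Λ, σ x = τ x) → σ ∈ S → τ ∈ S) :
    MeasurableSet[cylSigma Λ] S := by
  have : Finite Λ := hΛ
  refine ⟨(fun ω : DConf d => fun x : Λ => ω x) '' S, Set.Finite.measurableSet (Set.toFinite _), ?_⟩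
  ext τ
  constructor
  · rintro ⟨σ, hσ, h⟩
    exact hS σ τ (fun x hx => congrFun h ⟨x, hx⟩) hσ
  · exact fun h => ⟨τ, h, rfl⟩

theorem theta_succ (Γ γ : ℕ → ℝ) (k : ℕ) :
    theta Γ γ (k + 1) = theta Γ γ k + (Γ (k + 1) + γ (k + 1)) :=
  Finset.sum_range_succ _ _

theorem theta_nonneg {Γ γ : ℕ → ℝ} (hΓ : ∀ k, 0 ≤ Γ k) (hγ : ∀ k, 0 ≤ γ k) (k : ℕ) :
    0 ≤ theta Γ γ k :=
  Finset.sum_nonneg fun i _ => add_nonneg (hΓ i) (hγ i)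

/-- Gentleness of `x` depends only on the bad points within distance `Γ_k + γ_k` of `x`. -/
theorem gentleOn_of_agree {d : ℕ} {Γ γ : ℕ → ℝ} {B B' : Set (ZLat d)} {k : ℕ} {x : ZLat d}
    (hΓ : 0 ≤ Γ k) (hγ : 0 ≤ γ k)
    (h : ∀ y ∈ ball1 x (Γ k + γ k), y ∈ B ↔ y ∈ B') (hx : gentleOn Γ γ B k x) :
    gentleOn Γ γ B' k x := by
  have hsub {y} (hy : y ∈ ball1 x (Γ k)) : y ∈ ball1 x (Γ k + γ k) :=
    mem_ball1_of_le hy (s := 0) (by simp [D1_self]) (by linarith)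
  have back {y} (hy : y ∈ ball1 x (Γ k) ∩ B') : y ∈ ball1 x (Γ k) ∩ B :=
    ⟨hy.1, (h y (hsub hy.1)).2 hy.2⟩
  obtain ⟨h₁, h₂, h₃⟩ := hx
  refine ⟨(h x (mem_ball1_self x (by linarith))).1 h₁,
    fun u hu v hv => h₂ u (back hu) v (back hv), fun u hu v hv => ?_⟩
  by_contra! hle
  have hvB : v ∈ B := (h v (mem_ball1_of_le hu.1 hle le_rfl)).2 hv.1
  exact (h₃ u (back hu) v ⟨hvB, fun hv' => hv.2 ⟨hv'.1, hv.1⟩⟩).not_ge hle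

/-- Whether `x` is `k`-bad depends only on the disorder in `O_{θ_k}(x)`. -/
theorem mem_badSet_iff_of_agree {d : ℕ} {Γ γ : ℕ → ℝ} (hΓ : ∀ k, 0 ≤ Γ k) (hγ : ∀ k, 0 ≤ γ k)
    {σ τ : DConf d} (k : ℕ) {x : ZLat d} (h : ∀ y ∈ ball1 x (theta Γ γ k), σ y = τ y) :
    x ∈ badSet Γ γ σ k ↔ x ∈ badSet Γ γ τ k := by
  induction k generalizing x with
  | zero =>
    simp only [badSet, Set.mem_ofPred_eq, h x (mem_ball1_self x (theta_nonneg hΓ hγ 0))]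
  | succ k ih =>
    have hB : ∀ y ∈ ball1 x (Γ (k + 1) + γ (k + 1)),
        y ∈ badSet Γ γ σ k ↔ y ∈ badSet Γ γ τ k := fun y hy =>
      ih fun z hz => h z (mem_ball1_of_le hy hz (by rw [theta_succ]; linarith))
    have hx := hB x (mem_ball1_self x (add_nonneg (hΓ _) (hγ _)))
    have hg : gentleOn Γ γ (badSet Γ γ σ k) (k + 1) x ↔
        gentleOn Γ γ (badSet Γ γ τ k) (k + 1) x :=
      ⟨gentleOn_of_agree (hΓ _) (hγ _) hB,
        gentleOn_of_agree (hΓ _) (hγ _) fun y hy => (hB y hy).symm⟩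
    simp only [badSet, Set.mem_ofPred_eq, hx, hg]

theorem mem_badSet_iff_of_agree_succ {d : ℕ} {Γ γ : ℕ → ℝ} (hΓ : ∀ k, 0 ≤ Γ k)
    (hγ : ∀ k, 0 ≤ γ k) {σ τ : DConf d} (k : ℕ) {x : ZLat d}
    (h : ∀ y ∈ ball1 x (theta Γ γ (k + 1)), σ y = τ y) :
    ∀ y ∈ ball1 x (Γ (k + 1) + γ (k + 1)), y ∈ badSet Γ γ σ k ↔ y ∈ badSet Γ γ τ k :=
  fun _ hy => mem_badSet_iff_of_agree hΓ hγ k fun z hz =>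
    h z (mem_ball1_of_le hy hz (by rw [theta_succ]; linarith))

/-- Measurability of the gentle sets. For moderately steep scales, the
event `{ω : x ∈ G_k(ω)}` belongs to the σ-algebra generated by the coordinates in the
`ℓ¹`-ball `O_{θ_k}(x)`, and for finite `X` and `k ≥ 1` the event `{ω : X ∈ 𝒢_k(ω)}`
belongs to the σ-algebra generated by the coordinates in `O_{θ_k}(X)`. -/
theorem stmt4 {d : ℕ} (Γ γ : ℕ → ℝ) (a ε : ℝ) (hs : ModSteep d Γ γ a ε) :
    (∀ (x : ZLat d) (k : ℕ),
      MeasurableSet[cylSigma (ball1 x (theta Γ γ k))]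
        {ω : DConf d | x ∈ gentleSet Γ γ ω k}) ∧
    (∀ (X : Set (ZLat d)) (k : ℕ), X.Finite → 1 ≤ k →
      MeasurableSet[cylSigma (nbd1 X (theta Γ γ k))]
        {ω : DConf d | X ∈ atomsAt Γ γ ω k}) := by
  have hΓ (k : ℕ) : 0 ≤ Γ k := hs.gammaBigZero ▸ hs.gammaBigMono.monotone (Nat.zero_le k)
  have hγ (k : ℕ) : 0 ≤ γ k :=
    hs.gammaSmallZero.trans (hs.gammaSmallMono.monotone (Nat.zero_le k))
  refine ⟨fun x k => measurableSet_cylSigma_of_local (finite_ball1 x _) ?_,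
    fun X k hX hk => measurableSet_cylSigma_of_local (finite_nbd1 hX _) ?_⟩
  · rintro σ τ h hσ
    cases k with
    | zero => exact (h x (mem_ball1_self x (theta_nonneg hΓ hγ 0))).symm.trans hσ
    | succ k =>
      have hB := mem_badSet_iff_of_agree_succ hΓ hγ k h x
        (mem_ball1_self x (add_nonneg (hΓ _) (hγ _)))
      exact ⟨hB.1 hσ.1, fun hx => hσ.2 ((mem_badSet_iff_of_agree hΓ hγ (k + 1) h).2 hx)⟩
  · obtain ⟨k, rfl⟩ := Nat.exists_eq_add_of_le' hk
    rintro σ τ h ⟨x, hx, hXeq⟩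
    rw [Nat.add_sub_cancel] at hx hXeq
    have hxX : x ∈ X := hXeq ▸ ⟨mem_ball1_self x (hΓ _), hx.1⟩
    have hB := mem_badSet_iff_of_agree_succ hΓ hγ k fun y hy => h y ⟨x, hxX, hy⟩
    refine ⟨x, gentleOn_of_agree (hΓ _) (hγ _) hB hx, hXeq.trans ?_⟩
    ext y
    exact and_congr_right fun hy =>
      hB y (mem_ball1_of_le hy (s := 0) (by simp [D1_self]) (by linarith [hγ (k + 1)]))

end

end Paper
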